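/- arXiv:2309.00185 — 2 statements merged into one kernel-verified Lean document; each statement's English description precedes it below -/
import Mathlib

section
/- Let E be a real Banach space. The pseudometric D_E on the set of finite-dimensional subspaces of E, given by D_E(X,Y) = inf{ d_H(T(B_X), B_Y) : T ∈ Isom(E) }, is complete: for every sequence (X_n) of finite-dimensional subspaces of E which is D_E-Cauchy (for every ε > 0 there is N such that D_E(X_n, X_m) < ε for all n, m ≥ N), there exists a finite-dimensional subspace X of E with D_E(X_n, X) → 0. -/
noncomputable section

/-- The closed unit ball of a subspace `X` of `E`, viewed as a subset of `E`. -/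
def ballSet {E : Type*} [NormedAddCommGroup E] [NormedSpace ℝ E]
    (X : Subspace ℝ E) : Set E :=
  {x : E | x ∈ X ∧ ‖x‖ ≤ 1}

/-- The pseudometric `D_E(X,Y) = inf { d_H(T(B_X), B_Y) : T ∈ Isom(E) }` on finite-dimensional
subspaces of `E`. -/
def DistDE {E : Type*} [NormedAddCommGroup E] [NormedSpace ℝ E]
    (X Y : Subspace ℝ E) : ℝ :=
  ⨅ T : E ≃ₗᵢ[ℝ] E, Metric.hausdorffDist ((fun z => T z) '' ballSet X) (ballSet Y)

open Filter Topology TopologicalSpace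

section

variable {E : Type*} [NormedAddCommGroup E] [NormedSpace ℝ E]

lemma image_coe_closedBall_eq_ballSet (X : Subspace ℝ E) :
    ((↑) : X → E) '' Metric.closedBall 0 1 = ballSet X := by
  ext x
  simp [ballSet, and_comm]

lemma zero_mem_ballSet (X : Subspace ℝ E) : (0 : E) ∈ ballSet X := by
  simp [ballSet]

lemma isCompact_ballSet (X : Subspace ℝ E) [FiniteDimensional ℝ X] :
    IsCompact (ballSet X) := by
  have := FiniteDimensional.proper ℝ X
  rw [← image_coe_closedBall_eq_ballSet]
  exact (isCompact_closedBall 0 1).image continuous_subtype_val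

lemma finiteDimensional_of_isCompact_ballSet (X : Subspace ℝ E) (h : IsCompact (ballSet X)) :
    FiniteDimensional ℝ X := by
  rw [← image_coe_closedBall_eq_ballSet, ← Subtype.isCompact_iff] at h
  exact FiniteDimensional.of_isCompact_closedBall ℝ one_pos h

lemma image_ballSet (T : E ≃ₗᵢ[ℝ] E) (X : Subspace ℝ E) :
    (fun z => T z) '' ballSet X = ballSet (X.map T.toLinearEquiv.toLinearMap) := by
  ext x
  constructor
  · rintro ⟨z, ⟨hz, hz1⟩, rfl⟩
    exact ⟨⟨z, hz, rfl⟩, by simpa using hz1⟩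
  · rintro ⟨⟨z, hz, rfl⟩, hz1⟩
    exact ⟨z, ⟨hz, by simpa using hz1⟩, rfl⟩

lemma DistDE_le_hausdorffDist (X Y : Subspace ℝ E) (T : E ≃ₗᵢ[ℝ] E) :
    DistDE X Y ≤ Metric.hausdorffDist ((fun z => T z) '' ballSet X) (ballSet Y) :=
  ciInf_le ⟨0, by rintro _ ⟨T, rfl⟩; exact Metric.hausdorffDist_nonneg⟩ T

lemma DistDE_nonneg (X Y : Subspace ℝ E) : 0 ≤ DistDE X Y :=
  Real.iInf_nonneg fun _ => Metric.hausdorffDist_nonneg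

lemma exists_hausdorffDist_lt_of_DistDE_lt {X Y : Subspace ℝ E} {r : ℝ} (h : DistDE X Y < r) :
    ∃ T : E ≃ₗᵢ[ℝ] E, Metric.hausdorffDist ((fun z => T z) '' ballSet X) (ballSet Y) < r :=
  exists_lt_of_ciInf_lt h

lemma isBounded_ballSet (X : Subspace ℝ E) : Bornology.IsBounded (ballSet X) :=
  Metric.isBounded_closedBall.subset fun _ hx => mem_closedBall_zero_iff.2 hx.2

lemma hausdorffEDist_ballSet_ne_top (X Y : Subspace ℝ E) :
    Metric.hausdorffEDist (ballSet X) (ballSet Y) ≠ ⊤ :=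
  Metric.hausdorffEDist_ne_top_of_nonempty_of_bounded ⟨0, zero_mem_ballSet X⟩
    ⟨0, zero_mem_ballSet Y⟩ (isBounded_ballSet X) (isBounded_ballSet Y)

lemma DistDE_triangle (X Y Z : Subspace ℝ E) : DistDE X Z ≤ DistDE X Y + DistDE Y Z := by
  refine le_of_forall_pos_lt_add fun ε hε => ?_
  obtain ⟨T, hT⟩ := exists_hausdorffDist_lt_of_DistDE_lt
    (lt_add_of_pos_right (DistDE X Y) (half_pos hε))
  obtain ⟨S, hS⟩ := exists_hausdorffDist_lt_of_DistDE_lt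
    (lt_add_of_pos_right (DistDE Y Z) (half_pos hε))
  rw [← Metric.hausdorffDist_image S.isometry] at hT
  have himage : (fun z => (T.trans S) z) '' ballSet X = S '' ((fun z => T z) '' ballSet X) := by
    rw [Set.image_image]
    rfl
  have htri : Metric.hausdorffDist (S '' ((fun z => T z) '' ballSet X)) (ballSet Z) ≤
      Metric.hausdorffDist (S '' ((fun z => T z) '' ballSet X)) (S '' ballSet Y) +
        Metric.hausdorffDist (S '' ballSet Y) (ballSet Z) := by
    refine Metric.hausdorffDist_triangle ?_
    rw [Metric.hausdorffEDist_image S.isometry, image_ballSet]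
    exact hausdorffEDist_ballSet_ne_top _ _
  have hle := DistDE_le_hausdorffDist X Z (T.trans S)
  rw [himage] at hle
  linarith

/-- The closed unit ball of a finite-dimensional subspace, as a nonempty compact set. -/
def ballNonemptyCompacts (X : Subspace ℝ E) [FiniteDimensional ℝ X] : NonemptyCompacts E :=
  ⟨⟨ballSet X, isCompact_ballSet X⟩, ⟨0, zero_mem_ballSet X⟩⟩

/-- The subspace of limits of sequences `y` with `y k ∈ Y k` for all `k`. -/
def limitSubspace (Y : ℕ → Subspace ℝ E) : Subspace ℝ E where
  carrier := {z | ∃ y : ℕ → E, (∀ k, y k ∈ Y k) ∧ Tendsto y atTop (𝓝 z)}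
  zero_mem' := ⟨fun _ => 0, fun k => (Y k).zero_mem, tendsto_const_nhds⟩
  add_mem' := by
    rintro _ _ ⟨y, hy, hy'⟩ ⟨w, hw, hw'⟩
    exact ⟨fun k => y k + w k, fun k => (Y k).add_mem (hy k) (hw k), hy'.add hw'⟩
  smul_mem' := by
    rintro c _ ⟨y, hy, hy'⟩
    exact ⟨fun k => c • y k, fun k => (Y k).smul_mem c (hy k), hy'.const_smul c⟩

lemma exists_tendsto_mem_ballSet {Y : ℕ → Subspace ℝ E} {z : E} (hz : z ∈ limitSubspace Y)
    (hz1 : ‖z‖ ≤ 1) : ∃ y : ℕ → E, (∀ k, y k ∈ ballSet (Y k)) ∧ Tendsto y atTop (𝓝 z) := by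
  obtain ⟨y, hy, hyz⟩ := hz
  refine ⟨fun k => (max 1 ‖y k‖)⁻¹ • y k, fun k => ⟨(Y k).smul_mem _ (hy k), ?_⟩, ?_⟩
  · have hpos : 0 < max 1 ‖y k‖ := lt_max_of_lt_left one_pos
    rw [norm_smul, norm_inv, Real.norm_of_nonneg hpos.le, inv_mul_le_one₀ hpos]
    exact le_max_right _ _
  · have hmax : Tendsto (fun k => max 1 ‖y k‖) atTop (𝓝 1) := by
      simpa [hz1] using (tendsto_const_nhds (x := (1 : ℝ))).max hyz.norm
    simpa using (hmax.inv₀ one_ne_zero).smul hyz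

/-- A Hausdorff limit of unit balls of finite-dimensional subspaces is the unit ball of the
limit subspace. -/
lemma coe_eq_ballSet_limitSubspace {Y : ℕ → Subspace ℝ E} [∀ k, FiniteDimensional ℝ (Y k)]
    {K : NonemptyCompacts E} (h : Tendsto (fun k => ballNonemptyCompacts (Y k)) atTop (𝓝 K)) :
    (K : Set E) = ballSet (limitSubspace Y) := by
  have hd : Tendsto (fun k => Metric.hausdorffDist (ballSet (Y k)) K) atTop (𝓝 0) :=
    tendsto_iff_dist_tendsto_zero.1 h
  have hfin : ∀ k, Metric.hausdorffEDist (ballSet (Y k)) K ≠ ⊤ := fun k =>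
    Metric.hausdorffEDist_ne_top_of_nonempty_of_bounded ⟨0, zero_mem_ballSet _⟩ K.nonempty
      (isBounded_ballSet _) K.isCompact.isBounded
  ext z
  constructor
  · intro hz
    have hmem : ∀ k, ∃ y ∈ ballSet (Y k), Metric.infDist z (ballSet (Y k)) = dist z y := fun k =>
      (isCompact_ballSet (Y k)).exists_infDist_eq_dist ⟨0, zero_mem_ballSet _⟩ z
    choose y hy hyz using hmem
    have hlim : Tendsto y atTop (𝓝 z) := by
      refine tendsto_iff_dist_tendsto_zero.2 (squeeze_zero (fun _ => dist_nonneg) (fun k => ?_) hd)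
      rw [dist_comm, ← hyz, Metric.hausdorffDist_comm]
      exact Metric.infDist_le_hausdorffDist_of_mem hz (by
        rw [Metric.hausdorffEDist_comm]; exact hfin k)
    exact ⟨⟨y, fun k => (hy k).1, hlim⟩, le_of_tendsto' hlim.norm fun k => (hy k).2⟩
  · rintro ⟨hz, hz1⟩
    obtain ⟨y, hy, hyz⟩ := exists_tendsto_mem_ballSet hz hz1
    rw [K.isCompact.isClosed.mem_iff_infDist_zero K.nonempty]
    have hinf : Tendsto (fun k => Metric.infDist (y k) K) atTop (𝓝 0) :=
      squeeze_zero (fun _ => Metric.infDist_nonneg)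
        (fun k => Metric.infDist_le_hausdorffDist_of_mem (hy k) (hfin k)) hd
    exact tendsto_nhds_unique
      (((Metric.continuous_infDist_pt (K : Set E)).tendsto z).comp hyz) hinf

/-- The composition `(T 0)⁻¹ ∘ (T 1)⁻¹ ∘ ⋯ ∘ (T (k - 1))⁻¹`, which undoes the first `k` of the
successive isometries `T`. -/
def alignIsometry (T : ℕ → E ≃ₗᵢ[ℝ] E) : ℕ → E ≃ₗᵢ[ℝ] E
  | 0 => LinearIsometryEquiv.refl ℝ E
  | k + 1 => (T k).symm.trans (alignIsometry T k)

lemma hausdorffDist_alignIsometry (T : ℕ → E ≃ₗᵢ[ℝ] E) (k : ℕ) (A B : Set E) :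
    Metric.hausdorffDist ((fun z => alignIsometry T k z) '' A)
      ((fun z => alignIsometry T (k + 1) z) '' B) =
    Metric.hausdorffDist ((fun z => T k z) '' A) B := by
  have hA : (fun z => alignIsometry T k z) '' A =
      (alignIsometry T (k + 1)) '' ((fun z => T k z) '' A) := by
    simp [Set.image_image, alignIsometry]
  rw [hA]
  exact Metric.hausdorffDist_image (alignIsometry T (k + 1)).isometry

/-- A sequence with geometrically small consecutive `DistDE` converges. -/
lemma exists_tendsto_DistDE_of_lt_geometric [CompleteSpace E] (X : ℕ → Subspace ℝ E)
    [∀ k, FiniteDimensional ℝ (X k)] (h : ∀ k, DistDE (X k) (X (k + 1)) < (1 / 2) ^ k) :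
    ∃ Z : Subspace ℝ E, FiniteDimensional ℝ Z ∧
      Tendsto (fun k => DistDE (X k) Z) atTop (𝓝 0) := by
  choose T hT using fun k => exists_hausdorffDist_lt_of_DistDE_lt (h k)
  let Y : ℕ → Subspace ℝ E := fun k =>
    (X k).map (alignIsometry T k).toLinearEquiv.toLinearMap
  have hY : ∀ k, (fun z => alignIsometry T k z) '' ballSet (X k) = ballSet (Y k) := fun k =>
    image_ballSet _ _
  have : ∀ k, FiniteDimensional ℝ (Y k) := fun k => by
    dsimp only [Y]; infer_instance
  have hcauchy : CauchySeq fun k => ballNonemptyCompacts (Y k) := by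
    refine cauchySeq_of_le_geometric (1 / 2) 1 (by norm_num) fun k => ?_
    change Metric.hausdorffDist (ballSet (Y k)) (ballSet (Y (k + 1))) ≤ _
    rw [← hY, ← hY, hausdorffDist_alignIsometry, one_mul]
    exact (hT k).le
  obtain ⟨K, hK⟩ := cauchySeq_tendsto_of_complete hcauchy
  have hKZ := coe_eq_ballSet_limitSubspace hK
  refine ⟨limitSubspace Y, finiteDimensional_of_isCompact_ballSet _ (hKZ ▸ K.isCompact), ?_⟩
  refine squeeze_zero (fun _ => DistDE_nonneg _ _) (fun k => ?_)
    (tendsto_iff_dist_tendsto_zero.1 hK)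
  change _ ≤ Metric.hausdorffDist (ballSet (Y k)) K
  rw [hKZ, ← hY]
  exact DistDE_le_hausdorffDist _ _ _

end

/-- The pseudometric `D_E` is complete on the set of finite-dimensional subspaces of a real
Banach space `E`: every `D_E`-Cauchy sequence `D_E`-converges to some finite-dimensional
subspace. -/
theorem DistDE_complete
    (E : Type*) [NormedAddCommGroup E] [NormedSpace ℝ E] [CompleteSpace E]
    (X : ℕ → Subspace ℝ E) (hfd : ∀ n, FiniteDimensional ℝ (X n))
    (hcauchy : ∀ ε > (0 : ℝ), ∃ N : ℕ, ∀ m n : ℕ, N ≤ m → N ≤ n →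
      DistDE (X m) (X n) < ε) :
    ∃ Z : Subspace ℝ E, FiniteDimensional ℝ Z ∧
      Filter.Tendsto (fun n => DistDE (X n) Z) Filter.atTop (nhds 0) := by
  obtain ⟨φ, hφ, hlt⟩ := extraction_forall_of_eventually
    (P := fun k n => ∀ m, n ≤ m → DistDE (X n) (X m) < (1 / 2) ^ k) fun k => by
      obtain ⟨N, hN⟩ := hcauchy ((1 / 2) ^ k) (by positivity)
      filter_upwards [eventually_ge_atTop N] with n hn m hm
      exact hN n m hn (hn.trans hm)
  obtain ⟨Z, hZ, hlim⟩ := exists_tendsto_DistDE_of_lt_geometric (fun k => X (φ k))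
    fun k => hlt k _ (hφ.monotone k.le_succ)
  refine ⟨Z, hZ, Metric.tendsto_atTop.2 fun ε hε => ?_⟩
  obtain ⟨N, hN⟩ := hcauchy (ε / 2) (half_pos hε)
  obtain ⟨k, hk, hkN⟩ := ((hlim.eventually_lt_const (half_pos hε)).and
    (hφ.tendsto_atTop.eventually_ge_atTop N)).exists
  refine ⟨N, fun n hn => ?_⟩
  rw [Real.dist_0_eq_abs, abs_of_nonneg (DistDE_nonneg _ _)]
  linarith [DistDE_triangle (X n) (X (φ k)) Z, hN n (φ k) hn hkN]
end
end

section
/- Let E be a real Banach space, let X be a k-dimensional subspace of E (k ≥ 1), and let σ > 0 and ε ≥ 0 satisfy kε ≤ σ/(2+σ). If λ : X → E is a linear map with ‖λx − x‖ ≤ ε·‖x‖ for all x ∈ X, then there exists a surjective σ-isometry T : E → E (a linear bijection with (1+σ)⁻¹‖z‖ ≤ ‖Tz‖ ≤ (1+σ)‖z‖ for all z ∈ E) such that Tx = λx for all x ∈ X. -/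
noncomputable section

open Module

/-- **Auerbach's lemma**: a finite-dimensional real normed space has a basis of vectors of norm at
most one whose coordinate functionals have norm at most one. -/
theorem exists_auerbach_basis (X : Type*) [NormedAddCommGroup X] [NormedSpace ℝ X]
    [FiniteDimensional ℝ X] :
    ∃ e : Basis (Fin (finrank ℝ X)) ℝ X,
      (∀ i, ‖e i‖ ≤ 1) ∧ ∀ i x, |e.coord i x| ≤ ‖x‖ := by
  set b := finBasis ℝ X
  have hcont : Continuous fun v : Fin (finrank ℝ X) → X => |b.det v| := by
    simp only [Basis.det_apply]
    refine Continuous.abs (Continuous.matrix_det (continuous_matrix fun i j => ?_))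
    exact (b.coord i).continuous_of_finiteDimensional.comp (continuous_apply j)
  have : ProperSpace X := FiniteDimensional.proper ℝ X
  have hcomp : IsCompact (Set.univ.pi fun _ : Fin (finrank ℝ X) => Metric.closedBall (0 : X) 1) :=
    isCompact_univ_pi fun _ => isCompact_closedBall _ _
  obtain ⟨e, he, hmax⟩ := hcomp.exists_isMaxOn ⟨0, by simp⟩ hcont.continuousOn
  have he1 : ∀ i, ‖e i‖ ≤ 1 := fun i => by simpa using he i (Set.mem_univ i)
  have hpos : 0 < |b.det e| := by
    have hb : ∀ i, 0 < ‖b i‖ := fun i => norm_pos_iff.2 (b.ne_zero i)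
    have hle : |b.det fun i => ‖b i‖⁻¹ • b i| ≤ |b.det e| := hmax fun i _ => by
      simp [norm_smul, (hb i).ne']
    refine lt_of_lt_of_le (abs_pos.2 ?_) hle
    rw [AlternatingMap.map_smul_univ, b.det_self, smul_eq_mul, mul_one]
    exact Finset.prod_ne_zero_iff.2 fun i _ => inv_ne_zero (hb i).ne'
  obtain ⟨hli, hsp⟩ := (Basis.is_basis_iff_det b).2 (isUnit_iff_ne_zero.2 (abs_pos.1 hpos))
  have hunit : ∀ i (x : X), ‖x‖ ≤ 1 → |(Basis.mk hli hsp.ge).coord i x| ≤ 1 := by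
    intro i x hx
    have hdet := congrArg (fun f : X →ₗ[ℝ] ℝ => f x) (b.det_smul_mk_coord_eq_det_update hli hsp.ge i)
    have hle : |b.det (Function.update e i x)| ≤ |b.det e| := hmax fun j _ => by
      rcases eq_or_ne j i with rfl | hj
      · simpa using hx
      · simpa [hj] using he1 j
    have hdet' : b.det e * (Basis.mk hli hsp.ge).coord i x = b.det (Function.update e i x) := hdet
    rw [← hdet', abs_mul] at hle
    exact le_of_mul_le_mul_left (by simpa using hle) hpos
  refine ⟨Basis.mk hli hsp.ge, by simpa using he1, fun i x => ?_⟩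
  rcases eq_or_ne x 0 with rfl | hx
  · rw [map_zero, abs_zero, norm_zero]
  have hx' : 0 < ‖x‖ := norm_pos_iff.2 hx
  have h := hunit i (‖x‖⁻¹ • x) (by simp [norm_smul, hx'.ne'])
  rwa [map_smul, smul_eq_mul, abs_mul, abs_inv, abs_norm, inv_mul_le_iff₀ hx', mul_one] at h

/-- A linear map of bound `ε` on a finite-dimensional subspace `X` extends to the whole space with
operator norm at most `dim X * ε`. -/
theorem exists_extension_opNorm_le_finrank_mul {E F : Type*} [NormedAddCommGroup E]
    [NormedSpace ℝ E] [NormedAddCommGroup F] [NormedSpace ℝ F] (X : Subspace ℝ E)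
    [FiniteDimensional ℝ X] (f : X →ₗ[ℝ] F) {ε : ℝ} (hε : 0 ≤ ε) (hf : ∀ x, ‖f x‖ ≤ ε * ‖x‖) :
    ∃ S : E →L[ℝ] F, (∀ x : X, S x = f x) ∧ ‖S‖ ≤ finrank ℝ X * ε := by
  obtain ⟨e, he, hcoord⟩ := exists_auerbach_basis X
  have hext : ∀ i, ∃ g : StrongDual ℝ E, (∀ x : X, g x = e.coord i x) ∧ ‖g‖ ≤ 1 := by
    intro i
    obtain ⟨g, hg, hgn⟩ := exists_extension_norm_eq X
      ((e.coord i).mkContinuous 1 fun x => by simpa using hcoord i x)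
    exact ⟨g, hg, hgn.trans_le (LinearMap.mkContinuous_norm_le _ zero_le_one _)⟩
  choose g hg hgn using hext
  refine ⟨∑ i, (g i).smulRight (f (e i)), fun x => ?_, ?_⟩
  · conv_rhs => rw [← e.sum_repr x]
    simp only [hg, Basis.coord_apply, map_sum, map_smul, FunLike.coe_sum, Finset.sum_apply,
      ContinuousLinearMap.smulRight_apply]
  · refine (norm_sum_le _ _).trans ?_
    calc ∑ i, ‖(g i).smulRight (f (e i))‖ ≤ ∑ _i : Fin (finrank ℝ X), ε := by
          refine Finset.sum_le_sum fun i _ => ?_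
          rw [ContinuousLinearMap.norm_smulRight_apply]
          have h1 : ‖f (e i)‖ ≤ ε := (hf _).trans (mul_le_of_le_one_right hε (he i))
          exact (mul_le_of_le_one_left (norm_nonneg _) (hgn i)).trans h1
      _ = finrank ℝ X * ε := by simp

/-- A small perturbation of the identity on a `k`-dimensional subspace `X` of a real Banach
space `E` extends to a surjective `σ`-isometry of `E`, provided `kε ≤ σ/(2+σ)`. -/
theorem extension_of_identity_perturbation
    (E : Type*) [NormedAddCommGroup E] [NormedSpace ℝ E] [CompleteSpace E]
    (k : ℕ) (hk : 1 ≤ k) (X : Subspace ℝ E) [FiniteDimensional ℝ X]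
    (hX : finrank ℝ X = k)
    (σ ε : ℝ) (hσ : 0 < σ) (hε : 0 ≤ ε) (hkε : (k : ℝ) * ε ≤ σ / (2 + σ))
    (lam : X →ₗ[ℝ] E) (hlam : ∀ x : X, ‖lam x - (x : E)‖ ≤ ε * ‖x‖) :
    ∃ T : E ≃L[ℝ] E,
      (∀ z : E, (1 + σ)⁻¹ * ‖z‖ ≤ ‖T z‖ ∧ ‖T z‖ ≤ (1 + σ) * ‖z‖) ∧
      ∀ x : X, T (x : E) = lam x := by
  obtain ⟨S, hS, hSn⟩ := exists_extension_opNorm_le_finrank_mul X (lam - X.subtype) hε hlam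
  rw [hX] at hSn
  have hSσ : ‖S‖ ≤ σ / (2 + σ) := hSn.trans hkε
  have hlt : ‖-S‖ < 1 := by
    rw [norm_neg]
    exact hSσ.trans_lt ((div_lt_one (by linarith)).2 (by linarith))
  have hT : ∀ z, ContinuousLinearEquiv.ofUnit (Units.oneSub (-S) hlt) z = z + S z := by
    intro z
    change (1 - -S) z = z + S z
    simp
  have hupper : ‖S‖ ≤ σ := hSσ.trans (div_le_self hσ.le (by linarith))
  have hlower : (1 + σ)⁻¹ ≤ 1 - ‖S‖ := by
    have h : (1 + σ)⁻¹ ≤ 1 - σ / (2 + σ) := by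
      rw [one_sub_div (by linarith), inv_eq_one_div, div_le_div_iff₀] <;> linarith
    linarith
  refine ⟨ContinuousLinearEquiv.ofUnit (Units.oneSub (-S) hlt), fun z => ?_, fun x => ?_⟩
  · rw [hT]
    have hz := S.le_opNorm z
    constructor
    · have h1 := norm_sub_le_norm_add z (S z)
      have h2 := mul_le_mul_of_nonneg_right hlower (norm_nonneg z)
      linarith
    · have h1 := norm_add_le z (S z)
      have h2 := mul_le_mul_of_nonneg_right hupper (norm_nonneg z)
      linarith
  · rw [hT, hS]
    simp
end
end
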